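/- Fix an integer n ≥ 1. Suppose ẽ = (ẽ_1, …, ẽ_n) ∈ ℝ^n is attainable by a multisoliton of some degree N ≥ 0, i.e., there exist distinct positive reals β̃_1, …, β̃_N with ẽ_m = (−1)^{m+1}(2^{2m+1}/(2m+1)) Σ_{j=1}^{N} β̃_j^{2m+1} for m = 1, …, n. Suppose further that e = (e_1, …, e_n) ∈ ℝ^n is attainable by a multisoliton of degree at most n (there exist M ≤ n and distinct positive reals γ_1, …, γ_M with e_m = (−1)^{m+1}(2^{2m+1}/(2m+1)) Σ_{j=1}^{M} γ_j^{2m+1} for all m), and that ẽ_m ≤ e_m for every m = 1, …, n. Then ẽ is also attainable by a multisoliton of degree at most n: there exist M' ≤ n and distinct positive reals δ_1, …, δ_{M'} with ẽ_m = (−1)^{m+1}(2^{2m+1}/(2m+1)) Σ_{j=1}^{M'} δ_j^{2m+1} for all m. -/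

import Mathlib

/-- The constraint vector `e ∈ ℝⁿ` is attainable by a multisoliton of degree `N`:
there are distinct positive reals `β_1, …, β_N` with
`e_m = (-1)^{m+1} (2^{2m+1}/(2m+1)) ∑_j β_j^{2m+1}` for `m = 1, …, n`
(the index `m : Fin n` corresponds to the mathematical index `m + 1`). -/
def AttainsDeg (n N : ℕ) (e : Fin n → ℝ) : Prop :=
  ∃ β : Fin N → ℝ, Function.Injective β ∧ (∀ j, 0 < β j) ∧
    ∀ m : Fin n, e m = (-1 : ℝ) ^ (m : ℕ) * 2 ^ (2 * (m : ℕ) + 3) /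
      (2 * (m : ℕ) + 3 : ℝ) * ∑ j, β j ^ (2 * (m : ℕ) + 3)

/-- Counter of sign changes of `a - c`, starting from a negative sign. -/
noncomputable def signCount (a c : ℕ → ℝ) : ℕ → ℕ
  | 0 => 0
  | m + 1 => open Classical in
      if (Even (signCount a c m) ∧ c m < a m) ∨ (¬ Even (signCount a c m) ∧ a m < c m)
      then signCount a c m + 1 else signCount a c m

lemma signCount_succ_le (a c : ℕ → ℝ) (m : ℕ) : signCount a c (m + 1) ≤ signCount a c m + 1 := by
  rw [signCount]; split_ifs <;> omega

lemma signCount_add_le (a c : ℕ → ℝ) (m k : ℕ) :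
    signCount a c (m + k) ≤ signCount a c m + k := by
  induction k with
  | zero => simp
  | succ k ih => have := signCount_succ_le a c (m + k); rw [← add_assoc]; omega

lemma signCount_alternate (a c : ℕ → ℝ) (m n : ℕ) (h0 : signCount a c m = 0)
    (h : n ≤ signCount a c (m + n)) (j : ℕ) (hj : j < n) :
    (Even j → c (m + j) < a (m + j)) ∧ (¬ Even j → a (m + j) < c (m + j)) := by
  have key : ∀ j ≤ n, signCount a c (m + j) = j := by
    intro j hj
    have h1 := signCount_add_le a c m j
    have h2 := signCount_add_le a c (m + j) (n - j)
    rw [add_assoc, Nat.add_sub_cancel' hj] at h2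
    omega
  have h1 := key j hj.le
  have h2 := key (j + 1) hj
  rw [← add_assoc, signCount, h1] at h2
  split_ifs at h2 with hc
  · tauto
  · omega

lemma prod_sign_of_le (rs : List ℝ) (x : ℝ) (h : ∀ r ∈ rs, 0 ≤ r ∧ r ≤ x) :
    0 ≤ (-1 : ℝ) ^ rs.length * (rs.map (fun r => r ^ 2 - x ^ 2)).prod := by
  induction rs with
  | nil => simp
  | cons r rs ih =>
    have h1 := ih (fun r hr => h r (by simp [hr]))
    have h2 := h r (by simp)
    have h3 : 0 ≤ x ^ 2 - r ^ 2 := by nlinarith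
    simp only [List.length_cons, List.map_cons, List.prod_cons]
    calc (0 : ℝ) ≤ (x ^ 2 - r ^ 2) * ((-1 : ℝ) ^ rs.length *
        (rs.map (fun r => r ^ 2 - x ^ 2)).prod) := mul_nonneg h3 h1
      _ = _ := by ring

lemma exists_roots (a c : ℕ → ℝ) (L : ℕ) (ha : ∀ i j, i ≤ j → j < L → a i ≤ a j)
    (hc : ∀ i j, i ≤ j → j < L → c i ≤ c j) (ha0 : ∀ i < L, 0 ≤ a i) (hc0 : ∀ i < L, 0 ≤ c i)
    (m : ℕ) (hm : m ≤ L) :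
    ∃ rs : List ℝ, rs.length = signCount a c m ∧
      (∀ r ∈ rs, ∃ j < m, r = min (a j) (c j)) ∧
      (∀ i < m, ∀ x, min (a i) (c i) ≤ x → x ≤ max (a i) (c i) →
        (a i - c i) * (rs.map (fun r => r ^ 2 - x ^ 2)).prod ≤ 0) ∧
      (∀ i < m, a i ≠ c i → ∀ k, m ≤ k → k < L →
        (Even (signCount a c m) → max (a i) (c i) ≤ c k) ∧
        (¬ Even (signCount a c m) → max (a i) (c i) ≤ a k)) := by
  induction m with
  | zero => exact ⟨[], by simp [signCount]⟩
  | succ m ih =>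
    obtain ⟨rs, hlen, hroot, hsgn, hlast⟩ := ih (by omega)
    have hmL : m < L := by omega
    have hmin : ∀ j < m, min (a j) (c j) ≤ min (a m) (c m) := fun j hj =>
      min_le_min (ha j m hj.le hmL) (hc j m hj.le hmL)
    have hmin0 : ∀ j ≤ m, 0 ≤ min (a j) (c j) := fun j hj =>
      le_min (ha0 j (by omega)) (hc0 j (by omega))
    have hP : ∀ x, min (a m) (c m) ≤ x →
        0 ≤ (-1 : ℝ) ^ (signCount a c m) * (rs.map (fun r => r ^ 2 - x ^ 2)).prod := by
      intro x hx
      rw [← hlen]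
      apply prod_sign_of_le
      intro r hr
      obtain ⟨j, hj, rfl⟩ := hroot r hr
      exact ⟨hmin0 j hj.le, (hmin j hj).trans hx⟩
    by_cases hcond : (Even (signCount a c m) ∧ c m < a m) ∨ (¬ Even (signCount a c m) ∧ a m < c m)
    · have hs : signCount a c (m + 1) = signCount a c m + 1 := by rw [signCount, if_pos hcond]
      have hbd : ∀ i < m, a i ≠ c i → max (a i) (c i) ≤ min (a m) (c m) := by
        intro i hi hne
        obtain ⟨h1, h2⟩ := hlast i hi hne m le_rfl hmL
        rcases hcond with ⟨he, hlt⟩ | ⟨he, hlt⟩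
        · rw [min_eq_right hlt.le]; exact h1 he
        · rw [min_eq_left hlt.le]; exact h2 he
      refine ⟨min (a m) (c m) :: rs, by simp [hlen, hs], ?_, ?_, ?_⟩
      · intro r hr
        rcases List.mem_cons.1 hr with rfl | hr
        · exact ⟨m, by omega, rfl⟩
        · obtain ⟨j, hj, h⟩ := hroot r hr
          exact ⟨j, by omega, h⟩
      · intro i hi x hx1 hx2
        rw [List.map_cons, List.prod_cons]
        rcases Nat.lt_succ_iff_lt_or_eq.1 hi with hi | rfl
        · by_cases hne : a i = c i
          · simp [hne]
          have h1 := hbd i hi hne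
          have h2 := hsgn i hi x hx1 hx2
          have h3 := hmin0 i hi.le
          have h4 : 0 ≤ min (a m) (c m) ^ 2 - x ^ 2 := by nlinarith
          nlinarith
        · have h1 := hP x hx1
          have h3 := hmin0 i le_rfl
          have h4 : 0 ≤ x ^ 2 - min (a i) (c i) ^ 2 := by nlinarith
          rcases hcond with ⟨he, hlt⟩ | ⟨he, hlt⟩
          · rw [he.neg_one_pow, one_mul] at h1
            have := mul_nonneg (mul_nonneg (sub_nonneg.2 hlt.le) h4) h1
            nlinarith
          · rw [(Nat.not_even_iff_odd.1 he).neg_one_pow] at h1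
            have := mul_nonneg (mul_nonneg (sub_nonneg.2 hlt.le) h4) h1
            nlinarith
      · intro i hi hne k hk hkL
        have hi' : max (a i) (c i) ≤ max (a m) (c m) := by
          rcases Nat.lt_succ_iff_lt_or_eq.1 hi with hi | rfl
          · exact (hbd i hi hne).trans min_le_max
          · exact le_rfl
        rw [hs, Nat.even_add_one]
        rcases hcond with ⟨he, hlt⟩ | ⟨he, hlt⟩
        · refine ⟨fun h => absurd he h, fun _ => ?_⟩
          rw [max_eq_left hlt.le] at hi'
          exact hi'.trans (ha m k (by omega) hkL)
        · refine ⟨fun _ => ?_, fun h => absurd he h⟩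
          rw [max_eq_right hlt.le] at hi'
          exact hi'.trans (hc m k (by omega) hkL)
    · have hs : signCount a c (m + 1) = signCount a c m := by rw [signCount, if_neg hcond]
      refine ⟨rs, by rw [hlen, hs], ?_, ?_, ?_⟩
      · intro r hr
        obtain ⟨j, hj, h⟩ := hroot r hr
        exact ⟨j, by omega, h⟩
      · intro i hi x hx1 hx2
        rcases Nat.lt_succ_iff_lt_or_eq.1 hi with hi | rfl
        · exact hsgn i hi x hx1 hx2
        · have h1 := hP x hx1
          push Not at hcond
          by_cases he : Even (signCount a c i)
          · have h5 := hcond.1 he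
            rw [he.neg_one_pow, one_mul] at h1
            nlinarith
          · have h5 := hcond.2 he
            rw [(Nat.not_even_iff_odd.1 he).neg_one_pow] at h1
            nlinarith
      · intro i hi hne k hk hkL
        rw [hs]
        rcases Nat.lt_succ_iff_lt_or_eq.1 hi with hi | rfl
        · exact hlast i hi hne k (by omega) hkL
        · push Not at hcond
          refine ⟨fun he => ?_, fun he => ?_⟩
          · rw [max_eq_right (hcond.1 he)]; exact hc i k (by omega) hkL
          · rw [max_eq_left (hcond.2 he)]; exact ha i k (by omega) hkL

open Polynomial in
lemma exists_coeffs (rs : List ℝ) (n : ℕ) (hn : rs.length < n) :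
    ∃ d : ℕ → ℝ, (∀ m, 0 ≤ d m) ∧ ∀ x : ℝ, (rs.map (fun r => r ^ 2 - x ^ 2)).prod =
      ∑ m ∈ Finset.range n, (-1) ^ m * d m * x ^ (2 * m) := by
  have h : ∃ Q : ℝ[X], (∀ m, 0 ≤ Q.coeff m) ∧ Q.natDegree ≤ rs.length ∧
      ∀ x : ℝ, (rs.map (fun r => r ^ 2 - x ^ 2)).prod = Q.eval (- x ^ 2) := by
    clear hn
    induction rs with
    | nil =>
      refine ⟨1, fun m => ?_, by simp, by simp⟩
      rw [coeff_one]; split_ifs <;> norm_num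
    | cons r rs ih =>
      obtain ⟨Q, h1, h2, h3⟩ := ih
      refine ⟨(C (r ^ 2) + X) * Q, ?_, ?_, ?_⟩
      · intro m
        rw [add_mul, coeff_add, coeff_C_mul]
        have : 0 ≤ (X * Q).coeff m := by
          cases m with
          | zero => simp
          | succ m => rw [coeff_X_mul]; exact h1 m
        have := mul_nonneg (sq_nonneg r) (h1 m)
        linarith
      · refine natDegree_mul_le.trans ?_
        have : (C (r ^ 2) + X : ℝ[X]).natDegree ≤ 1 := by
          rw [add_comm]; exact (natDegree_X_add_C _).le
        simp only [List.length_cons]; omega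
      · intro x
        rw [List.map_cons, List.prod_cons, h3 x]
        simp only [eval_mul, eval_add, eval_C, eval_X]; ring
  obtain ⟨Q, h1, h2, h3⟩ := h
  refine ⟨Q.coeff, h1, fun x => ?_⟩
  rw [h3, eval_eq_sum_range' (lt_of_le_of_lt h2 hn)]
  refine Finset.sum_congr rfl fun m _ => ?_
  rw [neg_pow, pow_mul]; ring

/-- A monotonicity fact: if `H' = x² ∏ (r² - x²)` has the sign opposite to `a - c` between
`a` and `c`, then `H a ≤ H c`, with equality only for `a = c`. -/
lemma H_le (H : ℝ → ℝ) (rs : List ℝ) (hrs : ∀ r ∈ rs, 0 ≤ r)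
    (hH : ∀ x, HasDerivAt H (x ^ 2 * (rs.map (fun r => r ^ 2 - x ^ 2)).prod) x)
    (u v : ℝ) (hu : 0 ≤ u) (huv : u < v) (ε : ℝ) (hε : ε ≠ 0)
    (hs : ∀ x, u ≤ x → x ≤ v → ε * (rs.map (fun r => r ^ 2 - x ^ 2)).prod ≤ 0) :
    ε * H v < ε * H u := by
  have hd : ∀ x, HasDerivAt (fun x => ε * H x)
      (ε * (x ^ 2 * (rs.map (fun r => r ^ 2 - x ^ 2)).prod)) x := fun x => (hH x).const_mul ε
  have hanti : AntitoneOn (fun x => ε * H x) (Set.Icc u v) := by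
    apply antitoneOn_of_deriv_nonpos (convex_Icc u v)
    · exact fun x _ => (hd x).continuousAt.continuousWithinAt
    · exact fun x _ => (hd x).differentiableAt.differentiableWithinAt
    · intro x hx
      rw [interior_Icc] at hx
      rw [(hd x).deriv]
      have := hs x hx.1.le hx.2.le
      nlinarith [mul_nonneg (sq_nonneg x) (neg_nonneg.2 this)]
  have hle : ε * H v ≤ ε * H u :=
    hanti (Set.left_mem_Icc.2 huv.le) (Set.right_mem_Icc.2 huv.le) huv.le
  refine lt_of_le_of_ne hle fun heq => ?_
  obtain ⟨x, hx, hxr⟩ := ((Set.Ioo_infinite huv).sdiff (rs.toFinset.finite_toSet)).nonempty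
  have hconst : (fun x => ε * H x) =ᶠ[nhds x] fun _ => ε * H u := by
    filter_upwards [Ioo_mem_nhds hx.1 hx.2] with y hy
    have hy' : y ∈ Set.Icc u v := ⟨hy.1.le, hy.2.le⟩
    have h1 : ε * H y ≤ ε * H u := hanti (Set.left_mem_Icc.2 huv.le) hy' hy.1.le
    have h2 : ε * H v ≤ ε * H y := hanti hy' (Set.right_mem_Icc.2 huv.le) hy.2.le
    linarith
  have h0 := ((hasDerivAt_const x (ε * H u)).congr_of_eventuallyEq hconst).unique (hd x)
  have hx0 : 0 < x := lt_of_le_of_lt hu hx.1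
  have : (rs.map (fun r => r ^ 2 - x ^ 2)).prod = 0 := by
    rcases mul_eq_zero.1 h0.symm with h | h
    · exact absurd h hε
    · rcases mul_eq_zero.1 h with h | h
      · exact absurd h (by positivity)
      · exact h
  rw [List.prod_eq_zero_iff, List.mem_map] at this
  obtain ⟨r, hr, hrx⟩ := this
  have h4 : (r - x) * (r + x) = 0 := by linarith [hrx, (by ring : (r - x) * (r + x) = r ^ 2 - x ^ 2)]
  have h5 := hrs r hr
  rcases mul_eq_zero.1 h4 with h | h
  · apply hxr
    have : x = r := by linarith
    simpa [this] using hr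
  · linarith

lemma moment_compare (a c : ℕ → ℝ) (L n : ℕ) (ha : ∀ i j, i ≤ j → j < L → a i ≤ a j)
    (hc : ∀ i j, i ≤ j → j < L → c i ≤ c j) (ha0 : ∀ i < L, 0 ≤ a i) (hc0 : ∀ i < L, 0 ≤ c i)
    (hmom : ∀ m < n, 0 ≤ (-1 : ℝ) ^ m * (∑ i ∈ Finset.range L, a i ^ (2 * m + 3)
      - ∑ i ∈ Finset.range L, c i ^ (2 * m + 3)))
    (hcount : signCount a c L < n) : ∀ i < L, a i = c i := by
  obtain ⟨rs, hlen, hroot, hsgn, -⟩ := exists_roots a c L ha hc ha0 hc0 L le_rfl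
  obtain ⟨d, hd0, hd⟩ := exists_coeffs rs n (by omega)
  have hrs : ∀ r ∈ rs, 0 ≤ r := by
    intro r hr
    obtain ⟨j, hj, rfl⟩ := hroot r hr
    exact le_min (ha0 j hj) (hc0 j hj)
  set H : ℝ → ℝ := fun x => ∑ m ∈ Finset.range n,
    (-1) ^ m * d m / (2 * m + 3 : ℝ) * x ^ (2 * m + 3) with hHdef
  have hH : ∀ x, HasDerivAt H (x ^ 2 * (rs.map (fun r => r ^ 2 - x ^ 2)).prod) x := by
    intro x
    rw [hd x, Finset.mul_sum]
    apply HasDerivAt.fun_sum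
    intro m _
    have := (hasDerivAt_pow (2 * m + 3) x).const_mul ((-1) ^ m * d m / (2 * m + 3 : ℝ))
    refine this.congr_deriv ?_
    have h3 : (2 * m + 3 : ℝ) ≠ 0 := by positivity
    push_cast
    rw [pow_add]
    field_simp
  have hterm : ∀ i < L, a i ≠ c i → H (a i) < H (c i) := by
    intro i hi hne
    rcases lt_or_gt_of_ne hne with h | h
    · have := H_le H rs hrs hH (a i) (c i) (ha0 i hi) h (a i - c i) (sub_ne_zero.2 hne)
        (fun x h1 h2 => hsgn i hi x (by rwa [min_eq_left h.le]) (by rwa [max_eq_right h.le]))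
      nlinarith
    · have := H_le H rs hrs hH (c i) (a i) (hc0 i hi) h (a i - c i) (sub_ne_zero.2 hne)
        (fun x h1 h2 => hsgn i hi x (by rwa [min_eq_right h.le]) (by rwa [max_eq_left h.le]))
      nlinarith
  have hle : ∀ i ∈ Finset.range L, H (a i) ≤ H (c i) := by
    intro i hi
    by_cases hne : a i = c i
    · rw [hne]
    · exact (hterm i (Finset.mem_range.1 hi) hne).le
  have hswap : ∀ f : ℕ → ℝ, ∑ i ∈ Finset.range L, H (f i) = ∑ m ∈ Finset.range n,
      (-1) ^ m * d m / (2 * m + 3 : ℝ) * ∑ i ∈ Finset.range L, f i ^ (2 * m + 3) := by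
    intro f
    simp only [hHdef]
    rw [Finset.sum_comm]
    simp only [Finset.mul_sum]
  have hge : ∑ i ∈ Finset.range L, H (c i) ≤ ∑ i ∈ Finset.range L, H (a i) := by
    rw [hswap, hswap, ← sub_nonneg, ← Finset.sum_sub_distrib]
    apply Finset.sum_nonneg
    intro m hm
    have h1 := hmom m (Finset.mem_range.1 hm)
    have h2 : 0 ≤ d m / (2 * m + 3 : ℝ) := div_nonneg (hd0 m) (by positivity)
    calc (0 : ℝ) ≤ _ := mul_nonneg h2 h1
      _ = _ := by ring
  intro i hi
  by_contra hne
  have := Finset.sum_lt_sum hle ⟨i, Finset.mem_range.2 hi, hterm i hi hne⟩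
  linarith

/-- Sort and pad with zeros at the bottom. -/
lemma exists_pad {N L : ℕ} (hNL : N ≤ L) (β : Fin N → ℝ) (h0 : ∀ j, 0 ≤ β j) :
    ∃ a : ℕ → ℝ, (∀ i j, i ≤ j → j < L → a i ≤ a j) ∧ (∀ i < L, 0 ≤ a i) ∧
      (∀ k, ∑ i ∈ Finset.range L, a i ^ (k + 1) = ∑ j, β j ^ (k + 1)) ∧
      (∀ i < L - N, a i = 0) ∧
      (∀ i : Fin N, a (L - N + i) = β (Tuple.sort β i)) := by
  obtain ⟨D, rfl⟩ := Nat.exists_eq_add_of_le' hNL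
  rw [Nat.add_sub_cancel]
  set a : ℕ → ℝ := fun i => if h : D ≤ i ∧ i - D < N then β (Tuple.sort β ⟨i - D, h.2⟩) else 0
    with hadef
  have ha1 : ∀ i < D, a i = 0 := by
    intro i hi
    simp only [hadef]
    rw [dif_neg (by omega)]
  have ha2 : ∀ i : Fin N, a (D + i) = β (Tuple.sort β i) := by
    intro i
    simp only [hadef]
    rw [dif_pos (by have := i.2; omega)]
    congr 2
    ext; simp
  have ha0 : ∀ i, 0 ≤ a i := by
    intro i
    simp only [hadef]
    split_ifs
    · exact h0 _
    · exact le_rfl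
  refine ⟨a, ?_, fun i _ => ha0 i, ?_, ha1, ha2⟩
  · intro i j hij hj
    by_cases hi : i < D
    · rw [ha1 i hi]; exact ha0 j
    · have e1 := ha2 ⟨i - D, by omega⟩
      have e2 := ha2 ⟨j - D, by omega⟩
      simp only at e1 e2
      rw [Nat.add_sub_cancel' (by omega)] at e1 e2
      rw [e1, e2]
      apply Tuple.monotone_sort β
      simp only [Fin.mk_le_mk]; omega
  · intro k
    rw [show ∑ i ∈ Finset.range (D + N), a i ^ (k + 1) = ∑ i ∈ Finset.range D, a i ^ (k + 1) +
      ∑ i ∈ Finset.range N, a (D + i) ^ (k + 1) from Finset.sum_range_add _ _ _,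
      Finset.sum_eq_zero, zero_add, Finset.sum_range]
    · simp only [ha2]
      exact Equiv.sum_comp (Tuple.sort β) (fun j => β j ^ (k + 1))
    · intro i hi
      rw [ha1 i (Finset.mem_range.1 hi)]; simp

/-- Key rigidity. -/
lemma key_rigid {n N M : ℕ} (hn : 1 ≤ n) (hN : n < N) (hM : M ≤ n) (β : Fin N → ℝ) (γ : Fin M → ℝ)
    (b : Fin n → ℝ) (hβ : ∀ j, 0 < β j) (hγ : ∀ j, 0 < γ j)
    (hγi : Function.Injective γ) (hb : ∀ j, 0 ≤ b j)
    (h1 : ∀ m < n, 0 ≤ (-1 : ℝ) ^ m * (∑ j, b j ^ (2 * m + 3) - ∑ j, β j ^ (2 * m + 3)))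
    (h2 : ∀ m < n, 0 ≤ (-1 : ℝ) ^ m * (∑ j, γ j ^ (2 * m + 3) - ∑ j, b j ^ (2 * m + 3))) :
    Function.Injective b ∧ ∀ j, 0 < b j := by
  obtain ⟨A, hA1, hA2, hA3, hA4, hA5⟩ := exists_pad hN.le b hb
  obtain ⟨B, hB1, hB2, hB3, hB4, hB5⟩ := exists_pad le_rfl β (fun j => (hβ j).le)
  obtain ⟨b', hb1, hb2, hb3, -, hb5⟩ := exists_pad le_rfl b hb
  obtain ⟨g, hg1, hg2, hg3, hg4, hg5⟩ := exists_pad hM γ (fun j => (hγ j).le)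
  simp only [Nat.sub_self, zero_add] at hB5 hb5
  have hBpos : ∀ i < N, 0 < B i := fun i hi => by
    have := hB5 ⟨i, hi⟩; simp only at this; rw [this]; exact hβ _
  have hAb : ∀ i < n, A (N - n + i) = b' i := fun i hi => by
    have e1 := hA5 ⟨i, hi⟩
    have e2 := hb5 ⟨i, hi⟩
    simp only at e1 e2
    rw [e1, e2]
  -- first comparison
  have hcount1 : n ≤ signCount A B (N - n + n) := by
    by_contra hcon
    push Not at hcon
    rw [Nat.sub_add_cancel hN.le] at hcon
    have := moment_compare A B N n hA1 hB1 hA2 hB2 (fun m hm => by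
      rw [hA3 (2 * m + 2), hB3 (2 * m + 2)]; exact h1 m hm) hcon 0 (by omega)
    rw [hA4 0 (by omega)] at this
    have := hBpos 0 (by omega)
    linarith
  have hzero : ∀ i ≤ N - n, signCount A B i = 0 := by
    intro i
    induction i with
    | zero => intro _; rfl
    | succ i ih =>
      intro hi
      have h := ih (by omega)
      rw [signCount, h, if_neg]
      rintro (⟨-, h⟩ | ⟨h, -⟩)
      · rw [hA4 i (by omega)] at h
        have := hB2 i (by omega)
        linarith
      · simp at h
  have alt1 := signCount_alternate A B (N - n) n (hzero _ le_rfl) hcount1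
  have hb0 : 0 < b' 0 := by
    have := (alt1 0 (by omega)).1 (by simp)
    rw [hAb 0 (by omega)] at this
    have := hBpos (N - n + 0) (by omega)
    linarith
  have hstep : ∀ i, i + 1 < n → b' i < b' (i + 1) := by
    intro i hi
    by_cases hc : signCount g b' n < n
    · have heq := moment_compare g b' n n hg1 hb1 hg2 hb2 (fun m hm => by
        rw [hg3 (2 * m + 2), hb3 (2 * m + 2)]; exact h2 m hm) hc
      have hMn : n ≤ M := by
        by_contra hcon
        have e := heq 0 (by omega)
        rw [hg4 0 (by omega)] at e
        linarith
      obtain rfl : M = n := by omega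
      simp only [Nat.sub_self, zero_add] at hg5
      rw [← heq i (by omega), ← heq (i + 1) hi]
      have e1 := hg5 ⟨i, by omega⟩
      have e2 := hg5 ⟨i + 1, hi⟩
      simp only at e1 e2
      refine lt_of_le_of_ne (hg1 i (i + 1) (by omega) hi) ?_
      rw [e1, e2]
      intro h
      have := (Tuple.sort γ).injective (hγi h)
      simp at this
    · push Not at hc
      have alt2 := signCount_alternate g b' 0 n rfl (by rwa [zero_add])
      simp only [zero_add] at alt2
      by_cases he : Even i
      · have e1 := (alt2 i (by omega)).1 he
        have e2 := (alt2 (i + 1) hi).2 (by rw [Nat.even_add_one]; simpa using he)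
        have e3 := hg1 i (i + 1) (by omega) hi
        linarith
      · have e1 := (alt1 i (by omega)).2 he
        have e2 := (alt1 (i + 1) hi).1 (by rw [Nat.even_add_one]; exact he)
        rw [hAb _ (by omega)] at e1 e2
        have e3 := hB1 (N - n + i) (N - n + (i + 1)) (by omega) (by omega)
        linarith
  have hmono : ∀ i j, i < j → j < n → b' i < b' j := by
    intro i j hij
    induction j with
    | zero => omega
    | succ j ih =>
      intro hj
      rcases Nat.lt_succ_iff_lt_or_eq.1 hij with h | rfl
      · exact (ih h (by omega)).trans (hstep j hj)
      · exact hstep i hj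
  have hbs : ∀ j, b j = b' ((Tuple.sort b).symm j) := by
    intro j
    rw [hb5]; simp
  constructor
  · intro i j hij
    rw [hbs i, hbs j] at hij
    apply (Tuple.sort b).symm.injective
    rcases lt_trichotomy ((Tuple.sort b).symm i) ((Tuple.sort b).symm j) with h | h | h
    · have := hmono _ _ (Fin.lt_def.1 h) (Fin.is_lt _); linarith
    · exact h
    · have := hmono _ _ (Fin.lt_def.1 h) (Fin.is_lt _); linarith
  · intro j
    rw [hbs j]
    exact lt_of_lt_of_le hb0 (hb1 _ _ (Nat.zero_le _) (Fin.is_lt _))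

/-- The power-sum map. -/
def powMap (n : ℕ) (b : Fin n → ℝ) : Fin n → ℝ := fun m => ∑ j, b j ^ (2 * (m : ℕ) + 3)

lemma powMap_continuous (n : ℕ) : Continuous (powMap n) := by
  unfold powMap; fun_prop

lemma powMap_open {n : ℕ} (b : Fin n → ℝ) (hi : Function.Injective b) (hpos : ∀ j, 0 < b j) :
    Filter.map (powMap n) (nhds b) = nhds (powMap n b) := by
  set A : Matrix (Fin n) (Fin n) ℝ :=
    Matrix.of fun m j => (2 * (m : ℕ) + 3 : ℝ) * b j ^ (2 * (m : ℕ) + 2) with hA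
  have hstrict : HasStrictFDerivAt (powMap n) (LinearMap.toContinuousLinearMap A.toLin') b := by
    rw [hasStrictFDerivAt_pi']
    intro m
    have h : ∀ j ∈ Finset.univ, HasStrictFDerivAt (fun b : Fin n → ℝ => b j ^ (2 * (m : ℕ) + 3))
        (((2 * (m : ℕ) + 3 : ℕ) : ℝ) • b j ^ (2 * (m : ℕ) + 2) •
          (ContinuousLinearMap.proj (R := ℝ) (φ := fun _ : Fin n => ℝ) j)) b := by
      intro j _
      have := (hasStrictFDerivAt_apply (𝕜 := ℝ) (F' := fun _ : Fin n => ℝ) j b).pow (2 * (m : ℕ) + 3)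
      refine this.congr_fderiv ?_
      ext v
      simp
      ring
    have := HasStrictFDerivAt.fun_sum h
    refine this.congr_fderiv ?_
    ext v
    simp [hA, Matrix.toLin'_apply, Matrix.mulVec, dotProduct, Matrix.of_apply, mul_assoc]
  apply hstrict.map_nhds_eq_of_surj
  rw [LinearMap.range_eq_top]
  have hdet : IsUnit A := by
    rw [Matrix.isUnit_iff_isUnit_det, isUnit_iff_ne_zero]
    have hfac : A = Matrix.diagonal (fun m : Fin n => (2 * (m : ℕ) + 3 : ℝ)) *
        (Matrix.vandermonde (fun j => b j ^ 2)).transpose *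
        Matrix.diagonal (fun j => b j ^ 2) := by
      ext m j
      rw [Matrix.mul_diagonal, Matrix.diagonal_mul]
      simp [hA, Matrix.vandermonde_apply]
      ring
    rw [hfac, Matrix.det_mul, Matrix.det_mul, Matrix.det_transpose, Matrix.det_diagonal,
      Matrix.det_diagonal]
    refine mul_ne_zero (mul_ne_zero ?_ ?_) ?_
    · exact Finset.prod_ne_zero_iff.2 fun m _ => by positivity
    · rw [Matrix.det_vandermonde_ne_zero_iff]
      intro i j hij
      exact hi ((pow_left_inj₀ (hpos i).le (hpos j).le two_ne_zero).1 hij)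
    · exact Finset.prod_ne_zero_iff.2 fun j _ => pow_ne_zero _ (hpos j).ne'
  intro y
  refine ⟨A⁻¹.mulVec y, ?_⟩
  simp [Matrix.toLin'_apply, Matrix.mulVec_mulVec,
    Matrix.mul_nonsing_inv A ((Matrix.isUnit_iff_isUnit_det A).1 hdet)]

lemma powMap_closed {n : ℕ} (hn : 1 ≤ n) : IsClosed (powMap n '' {b | ∀ j, 0 ≤ b j}) := by
  apply IsSeqClosed.isClosed
  intro x y hx hxy
  choose b hb hbx using hx
  have hy := hxy.bddAbove_range
  obtain ⟨C, hC⟩ := hy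
  have hbd : ∀ k, b k ∈ Set.Icc (0 : Fin n → ℝ) (fun _ => C ⟨0, hn⟩ + 1) := by
    intro k
    refine ⟨hb k, fun j => ?_⟩
    have h1 : x k ⟨0, hn⟩ ≤ C ⟨0, hn⟩ := hC ⟨k, rfl⟩ _
    rw [← hbx k] at h1
    have h2 : b k j ^ 3 ≤ powMap n (b k) ⟨0, hn⟩ := by
      simp only [powMap, mul_zero, zero_add]
      exact Finset.single_le_sum (f := fun j => b k j ^ 3)
        (fun j _ => pow_nonneg (hb k j) 3) (Finset.mem_univ j)
    have h3 := hb k j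
    by_contra hcon
    push Not at hcon
    have h4 : 0 ≤ b k j ^ 3 := pow_nonneg h3 3
    have h5 : 1 < b k j := by linarith
    have h6 : b k j ≤ b k j ^ 3 := le_self_pow₀ h5.le (by norm_num)
    linarith
  obtain ⟨b₀, hb₀, φ, hφ, hlim⟩ := isCompact_Icc.tendsto_subseq hbd
  refine ⟨b₀, hb₀.1, ?_⟩
  have l1 := ((powMap_continuous n).tendsto b₀).comp hlim
  have l2 := hxy.comp hφ.tendsto_atTop
  refine tendsto_nhds_unique l1 (l2.congr fun k => ?_)
  simp [hbx]

lemma main_pow {n N M : ℕ} (hn : 1 ≤ n) (hN : n < N) (hM : M ≤ n) (β : Fin N → ℝ) (γ : Fin M → ℝ)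
    (hβ : ∀ j, 0 < β j) (hγ : ∀ j, 0 < γ j) (hγi : Function.Injective γ)
    (h : ∀ m < n, 0 ≤ (-1 : ℝ) ^ m * (∑ j, γ j ^ (2 * m + 3) - ∑ j, β j ^ (2 * m + 3))) :
    ∃ b : Fin n → ℝ, Function.Injective b ∧ (∀ j, 0 < b j) ∧
      ∀ m : Fin n, ∑ j, b j ^ (2 * (m : ℕ) + 3) = ∑ j, β j ^ (2 * (m : ℕ) + 3) := by
  set p : ℝ → Fin n → ℝ := fun t m => ∑ j, γ j ^ (2 * (m : ℕ) + 3) +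
    t * (∑ j, β j ^ (2 * (m : ℕ) + 3) - ∑ j, γ j ^ (2 * (m : ℕ) + 3)) with hp
  have hpc : Continuous p := by rw [hp]; fun_prop
  set K := powMap n '' {b | ∀ j, 0 ≤ b j} with hK
  have hrig : ∀ t ∈ Set.Icc (0 : ℝ) 1, ∀ b : Fin n → ℝ, (∀ j, 0 ≤ b j) → powMap n b = p t →
      Function.Injective b ∧ ∀ j, 0 < b j := by
    intro t ht b hb hbt
    have hb' : ∀ m < n, ∑ j, b j ^ (2 * m + 3) = ∑ j, γ j ^ (2 * m + 3) +
        t * (∑ j, β j ^ (2 * m + 3) - ∑ j, γ j ^ (2 * m + 3)) := fun m hm =>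
      congrFun hbt ⟨m, hm⟩
    refine key_rigid hn hN hM β γ b hβ hγ hγi hb (fun m hm => ?_) (fun m hm => ?_)
    · rw [hb' m hm]
      have := mul_nonneg (sub_nonneg.2 ht.2) (h m hm)
      linarith
    · rw [hb' m hm]
      have := mul_nonneg ht.1 (h m hm)
      linarith
  have hsub : Set.Icc (0 : ℝ) 1 ⊆ p ⁻¹' K := by
    apply IsClosed.Icc_subset_of_forall_mem_nhdsWithin
    · exact ((powMap_closed hn).preimage hpc).inter isClosed_Icc
    · obtain ⟨g, -, hg2, hg3, -, -⟩ := exists_pad hM γ (fun j => (hγ j).le)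
      refine ⟨fun i => g i, fun j => hg2 j j.2, ?_⟩
      ext m
      simp only [powMap, hp, zero_mul, add_zero]
      rw [← hg3 (2 * (m : ℕ) + 2), Finset.sum_range]
    · rintro t ⟨⟨b, hb, hbt⟩, ht⟩
      obtain ⟨hbi, hbp⟩ := hrig t ⟨ht.1, ht.2.le⟩ b hb hbt
      have hopen := powMap_open b hbi hbp
      have hnb : {b : Fin n → ℝ | ∀ j, 0 ≤ b j} ∈ nhds b := by
        have : ∀ᶠ b' in nhds b, ∀ j, 0 ≤ b' j := by
          rw [Filter.eventually_all]
          intro j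
          filter_upwards [(continuous_apply j).continuousAt.eventually (lt_mem_nhds (hbp j))]
            with b' hb' using le_of_lt hb'
        exact this
      have hKn : K ∈ nhds (p t) := by
        rw [← hbt, ← hopen]; exact Filter.image_mem_map hnb
      exact mem_nhdsWithin_of_mem_nhds (hpc.continuousAt hKn)
  obtain ⟨b, hb, hb1⟩ := hsub (Set.right_mem_Icc.2 zero_le_one)
  obtain ⟨hbi, hbp⟩ := hrig 1 (Set.right_mem_Icc.2 zero_le_one) b hb hb1
  refine ⟨b, hbi, hbp, fun m => ?_⟩
  have := congrFun hb1 m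
  simpa [powMap, hp] using this

theorem stmt_5 (n : ℕ) (hn : 1 ≤ n) (e e' : Fin n → ℝ)
    (he' : ∃ N : ℕ, AttainsDeg n N e')
    (he : ∃ M ≤ n, AttainsDeg n M e)
    (hle : ∀ m, e' m ≤ e m) :
    ∃ M' ≤ n, AttainsDeg n M' e' := by
  obtain ⟨N, β, hβi, hβ, hβe⟩ := he'
  by_cases hN : N ≤ n
  · exact ⟨N, hN, β, hβi, hβ, hβe⟩
  push Not at hN
  obtain ⟨M, hM, γ, hγi, hγ, hγe⟩ := he
  obtain ⟨b, hbi, hbp, hbe⟩ := main_pow hn hN hM β γ hβ hγ hγi (fun m hm => by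
    have h := hle ⟨m, hm⟩
    rw [hβe, hγe, ← sub_nonneg] at h
    simp only at h
    have hk : (0 : ℝ) < 2 ^ (2 * m + 3) / (2 * (m : ℝ) + 3) := by positivity
    refine nonneg_of_mul_nonneg_right (a := 2 ^ (2 * m + 3) / (2 * (m : ℝ) + 3)) ?_ hk
    calc (0 : ℝ) ≤ _ := h
      _ = _ := by ring)
  exact ⟨n, le_rfl, b, hbi, hbp, fun m => by rw [hbe m]; exact hβe m⟩
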